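/- Let (Y, Σ) be a measurable space, H a probability measure on Y, g : Y → [0, ∞) measurable, z ≥ 0, and let θ > q > 0, with ∫ log(1 + z g(y)) H(dy) < ∞. Writing L(u) = ∫ log(1 + u z g(y)) H(dy), one has (Γ(θ+1)/(Γ(q)Γ(θ+1−q))) ∫₀¹ u^{q−1} (1−u)^{θ−q} e^{−θ L(u)} ( ∫ (1 + u z g(y))^{−1} H(dy) ) du = (Γ(θ)/(Γ(q)Γ(θ−q))) ∫₀¹ u^{q−1} (1−u)^{θ−q−1} e^{−θ L(u)} du. -/

import Mathlib

open MeasureTheory Set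

theorem intervalIntegrable_rpow_mul_one_sub_rpow {a b : ℝ} (ha : 0 < a) (hb : 0 < b) :
    IntervalIntegrable (fun u : ℝ => u ^ (a - 1) * (1 - u) ^ (b - 1)) volume 0 1 := by
  have h := (Complex.betaIntegral_convergent (u := a) (v := b) (by simpa) (by simpa)).norm
  rw [intervalIntegrable_iff_integrableOn_Ioo_of_le zero_le_one] at h ⊢
  refine h.congr_fun (fun u hu => ?_) measurableSet_Ioo
  have h1 : (1 - (u : ℂ)) = ((1 - u : ℝ) : ℂ) := by push_cast; rfl
  simp only [norm_mul]
  rw [h1, Complex.norm_cpow_eq_rpow_re_of_pos hu.1,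
    Complex.norm_cpow_eq_rpow_re_of_pos (sub_pos.2 hu.2)]
  simp

section LogIntegral

variable {Y : Type*} [MeasurableSpace Y] {H : Measure Y} {w : Y → ℝ}

theorem norm_log_one_add_mul_le {u x : ℝ} (hx : 0 ≤ x) (hu : u ∈ Icc (0 : ℝ) 1) :
    ‖Real.log (1 + u * x)‖ ≤ Real.log (1 + x) := by
  have h := mul_nonneg hu.1 hx
  rw [Real.norm_of_nonneg (Real.log_nonneg (by linarith))]
  exact Real.log_le_log (by linarith) (by linarith [mul_le_of_le_one_left hx hu.2])

theorem continuousOn_integral_log_one_add_mul (hw : Measurable w) (hw0 : ∀ y, 0 ≤ w y)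
    (hint : Integrable (fun y => Real.log (1 + w y)) H) :
    ContinuousOn (fun u : ℝ => ∫ y, Real.log (1 + u * w y) ∂H) (Icc 0 1) := by
  refine continuousOn_of_dominated (fun u _ => ?_)
    (fun u hu => .of_forall fun y => norm_log_one_add_mul_le (hw0 y) hu) hint
    (.of_forall fun y => ?_)
  · exact (by fun_prop : Measurable fun y => Real.log (1 + u * w y)).aestronglyMeasurable
  · refine ContinuousOn.log (by fun_prop) fun u hu => ?_
    have := mul_nonneg hu.1 (hw0 y)
    positivity

theorem continuousOn_integral_inv_one_add_mul [IsFiniteMeasure H] (hw : Measurable w)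
    (hw0 : ∀ y, 0 ≤ w y) :
    ContinuousOn (fun u : ℝ => ∫ y, (1 + u * w y)⁻¹ ∂H) (Ici 0) := by
  refine continuousOn_of_dominated (bound := fun _ => 1) (fun u _ => ?_)
    (fun u hu => .of_forall fun y => ?_) (integrable_const _) (.of_forall fun y => ?_)
  · exact (by fun_prop : Measurable fun y => (1 + u * w y)⁻¹).aestronglyMeasurable
  · have := mul_nonneg hu (hw0 y)
    rw [Real.norm_of_nonneg (by positivity)]
    exact inv_le_one_of_one_le₀ (by linarith)
  · refine ContinuousOn.inv₀ (by fun_prop) fun u hu => ?_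
    have := mul_nonneg hu (hw0 y)
    positivity

theorem hasDerivAt_integral_log_one_add_mul [IsProbabilityMeasure H] (hw : Measurable w)
    (hw0 : ∀ y, 0 ≤ w y) (hint : Integrable (fun y => Real.log (1 + w y)) H)
    {u : ℝ} (hu : u ∈ Ioo (0 : ℝ) 1) :
    HasDerivAt (fun u : ℝ => ∫ y, Real.log (1 + u * w y) ∂H)
      ((1 - ∫ y, (1 + u * w y)⁻¹ ∂H) / u) u := by
  have hmeas (v : ℝ) : AEStronglyMeasurable (fun y => Real.log (1 + v * w y)) H :=
    (by fun_prop : Measurable fun y => Real.log (1 + v * w y)).aestronglyMeasurable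
  have key := hasDerivAt_integral_of_dominated_loc_of_deriv_le (μ := H)
    (F := fun v y => Real.log (1 + v * w y)) (F' := fun v y => w y / (1 + v * w y))
    (bound := fun _ => 2 / u) (Ioi_mem_nhds (half_lt_self hu.1)) (.of_forall hmeas)
    (hint.mono' (hmeas u) (.of_forall fun y => norm_log_one_add_mul_le (hw0 y) ⟨hu.1.le, hu.2.le⟩))
    (by fun_prop : Measurable fun y => w y / (1 + u * w y)).aestronglyMeasurable
    (.of_forall fun y v hv => ?_) (integrable_const _) (.of_forall fun y v hv => ?_)
  · have hinv : Integrable (fun y => (1 + u * w y)⁻¹) H := by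
      refine (integrable_const (1 : ℝ)).mono'
        (by fun_prop : Measurable fun y => (1 + u * w y)⁻¹).aestronglyMeasurable
        (.of_forall fun y => ?_)
      have := mul_nonneg hu.1.le (hw0 y)
      rw [Real.norm_of_nonneg (by positivity)]
      exact inv_le_one_of_one_le₀ (by linarith)
    have hpt : (fun y => w y / (1 + u * w y)) = fun y => (1 - (1 + u * w y)⁻¹) / u := by
      funext y
      have := mul_nonneg hu.1.le (hw0 y)
      have h1 : 1 + u * w y ≠ 0 := by positivity
      rw [div_eq_div_iff h1 hu.1.ne', sub_mul, inv_mul_cancel₀ h1]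
      ring
    refine key.2.congr_deriv ?_
    rw [hpt, integral_div, integral_sub (integrable_const _) hinv]
    simp
  · have hu0 := hu.1
    have hv0 : 0 < v := lt_trans (half_pos hu0) hv
    have := hw0 y
    rw [Real.norm_of_nonneg (by positivity), div_le_div_iff₀ (by positivity) hu0]
    have : u / 2 * w y ≤ v * w y := mul_le_mul_of_nonneg_right (le_of_lt hv) this
    linarith
  · have hv0 : 0 < v := lt_trans (half_pos hu.1) hv
    have := hw0 y
    have h := (((hasDerivAt_id v).mul_const (w y)).const_add 1).log (by simp; positivity)
    simpa using h

end LogIntegral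

theorem integral_beta_mul_exp_mul_eq {θ q : ℝ} (hq : 0 < q) (hθq : q < θ) {L A : ℝ → ℝ}
    (hL : ContinuousOn L (Icc 0 1)) (hA : ContinuousOn A (Icc 0 1))
    (hLA : ∀ u ∈ Ioo (0 : ℝ) 1, HasDerivAt L ((1 - A u) / u) u) :
    θ * ∫ u in Ioo (0 : ℝ) 1, u ^ (q - 1) * (1 - u) ^ (θ - q) * Real.exp (-(θ * L u)) * A u =
      (θ - q) *
        ∫ u in Ioo (0 : ℝ) 1, u ^ (q - 1) * (1 - u) ^ (θ - q - 1) * Real.exp (-(θ * L u)) := by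
  have hexp : ContinuousOn (fun u => Real.exp (-(θ * L u))) (uIcc 0 1) := by
    rw [uIcc_of_le zero_le_one]
    fun_prop
  have h1 : IntervalIntegrable
      (fun u => u ^ (q - 1) * (1 - u) ^ (θ - q) * Real.exp (-(θ * L u)) * A u) volume 0 1 := by
    have h := intervalIntegrable_rpow_mul_one_sub_rpow hq (b := θ - q + 1) (by linarith)
    rw [add_sub_cancel_right] at h
    exact (h.mul_continuousOn hexp).mul_continuousOn (by rwa [uIcc_of_le zero_le_one])
  have h2 : IntervalIntegrable
      (fun u => u ^ (q - 1) * (1 - u) ^ (θ - q - 1) * Real.exp (-(θ * L u))) volume 0 1 :=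
    (intervalIntegrable_rpow_mul_one_sub_rpow hq (sub_pos.2 hθq)).mul_continuousOn hexp
  have hcont : ContinuousOn
      (fun u => u ^ q * (1 - u) ^ (θ - q) * Real.exp (-(θ * L u))) (Icc 0 1) := by
    rw [uIcc_of_le zero_le_one] at hexp
    refine ContinuousOn.mul (ContinuousOn.mul ?_ ?_) hexp
    · exact continuousOn_id.rpow_const fun _ _ => Or.inr hq.le
    · exact ContinuousOn.rpow_const (by fun_prop) fun _ _ => Or.inr (sub_pos.2 hθq).le
  have hderiv : ∀ u ∈ Ioo (0 : ℝ) 1, HasDerivAt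
      (fun u => u ^ q * (1 - u) ^ (θ - q) * Real.exp (-(θ * L u)))
      (θ * (u ^ (q - 1) * (1 - u) ^ (θ - q) * Real.exp (-(θ * L u)) * A u) -
        (θ - q) * (u ^ (q - 1) * (1 - u) ^ (θ - q - 1) * Real.exp (-(θ * L u)))) u := by
    intro u hu
    have hu0 := hu.1.ne'
    have hu1 : 0 < 1 - u := sub_pos.2 hu.2
    have d1 : HasDerivAt (fun u : ℝ => u ^ q) (q * u ^ (q - 1)) u :=
      Real.hasDerivAt_rpow_const (Or.inl hu0)
    have d2 : HasDerivAt (fun u : ℝ => (1 - u) ^ (θ - q)) _ u :=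
      ((hasDerivAt_id u).const_sub 1).rpow_const (Or.inl hu1.ne')
    have d3 : HasDerivAt (fun u => Real.exp (-(θ * L u))) _ u :=
      ((hLA u hu).const_mul θ).neg.exp
    refine ((d1.mul d2).mul d3).congr_deriv ?_
    have e1 : u ^ q = u ^ (q - 1) * u := by
      rw [Real.rpow_sub_one hu0, div_mul_cancel₀ _ hu0]
    have e2 : (1 - u) ^ (θ - q) = (1 - u) ^ (θ - q - 1) * (1 - u) := by
      rw [Real.rpow_sub_one hu1.ne', div_mul_cancel₀ _ hu1.ne']
    simp only [id, Pi.mul_apply, Pi.neg_apply]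
    rw [e1, e2]
    field_simp
    ring
  have hFTC := intervalIntegral.integral_eq_sub_of_hasDerivAt_of_le zero_le_one hcont hderiv
    ((h1.const_mul θ).sub (h2.const_mul (θ - q)))
  rw [intervalIntegral.integral_sub (h1.const_mul θ) (h2.const_mul (θ - q)),
    intervalIntegral.integral_const_mul, intervalIntegral.integral_const_mul,
    intervalIntegral.integral_of_le zero_le_one, intervalIntegral.integral_of_le zero_le_one,
    integral_Ioc_eq_integral_Ioo, integral_Ioc_eq_integral_Ioo, sub_self,
    Real.zero_rpow hq.ne', Real.zero_rpow (sub_pos.2 hθq).ne'] at hFTC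
  simpa [sub_eq_zero] using hFTC

theorem stmt8 {Y : Type*} [MeasurableSpace Y] (H : Measure Y) [IsProbabilityMeasure H]
    (g : Y → ℝ) (hg : Measurable g) (hg0 : ∀ y, 0 ≤ g y)
    (z θ q : ℝ) (hz : 0 ≤ z) (hq : 0 < q) (hθq : q < θ)
    (hint : Integrable (fun y => Real.log (1 + z * g y)) H)
    (L : ℝ → ℝ) (hL : ∀ u, L u = ∫ y, Real.log (1 + u * z * g y) ∂H) :
    (Real.Gamma (θ + 1) / (Real.Gamma q * Real.Gamma (θ + 1 - q))) *
        ∫ u in Ioo (0:ℝ) 1,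
          u ^ (q - 1) * (1 - u) ^ (θ - q) * Real.exp (-(θ * L u)) *
            ∫ y, (1 + u * z * g y)⁻¹ ∂H =
      (Real.Gamma θ / (Real.Gamma q * Real.Gamma (θ - q))) *
        ∫ u in Ioo (0:ℝ) 1, u ^ (q - 1) * (1 - u) ^ (θ - q - 1) * Real.exp (-(θ * L u)) := by
  have hw : Measurable fun y => z * g y := hg.const_mul z
  have hw0 (y : Y) : 0 ≤ z * g y := mul_nonneg hz (hg0 y)
  have hθ : 0 < θ := hq.trans hθq
  have hθq' : 0 < θ - q := sub_pos.2 hθq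
  obtain rfl : L = fun u => ∫ y, Real.log (1 + u * (z * g y)) ∂H := by
    funext u
    simp only [hL, mul_assoc]
  have key := integral_beta_mul_exp_mul_eq hq hθq
    (continuousOn_integral_log_one_add_mul hw hw0 hint)
    ((continuousOn_integral_inv_one_add_mul (H := H) hw hw0).mono Icc_subset_Ici_self)
    (fun u hu => hasDerivAt_integral_log_one_add_mul hw hw0 hint hu)
  simp only [mul_assoc _ z] at key ⊢
  rw [show θ + 1 - q = θ - q + 1 by ring, Real.Gamma_add_one hθ.ne', Real.Gamma_add_one hθq'.ne']
  have hΓq := (Real.Gamma_pos_of_pos hq).ne'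
  have hΓ := (Real.Gamma_pos_of_pos hθq').ne'
  rw [div_mul_eq_mul_div, div_mul_eq_mul_div, div_eq_div_iff
    (mul_ne_zero hΓq (mul_ne_zero hθq'.ne' hΓ)) (mul_ne_zero hΓq hΓ)]
  linear_combination (Real.Gamma θ * Real.Gamma q * Real.Gamma (θ - q)) * key
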